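/- Let τ ∈ ℂ with Im τ > 0 and define θ(ξ;τ) := exp(πiτ/6)·exp(−πiξ)·∏_{j=0}^{∞}(1 − exp(2πi(jτ+ξ)))·∏_{j=1}^{∞}(1 − exp(2πi(jτ−ξ))) for ξ ∈ ℂ (both infinite products converge absolutely since |exp(2πiτ)| < 1). Then for every integer n ≥ 1 and every ξ ∈ ℂ one has ∏_{k=0}^{n−1} θ(ξ + kτ; τ) = (−1)^{n(n−1)/2} · ( ∏_{k=0}^{n−1} θ(ξ + kτ; nτ) )^{n}. -/

import Mathlib

/-- The theta function
`θ(ξ;τ) = exp(πiτ/6)·exp(−πiξ)·∏_{j≥0}(1 − e^{2πi(jτ+ξ)})·∏_{j≥1}(1 − e^{2πi(jτ−ξ)})`,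
i.e. `θ_q(z) = q^{1/12} z^{-1/2} ∏_{j≥0}(1-q^j z) ∏_{j>0}(1-q^j z^{-1})` with
`q = e^{2πiτ}`, `z = e^{2πiξ}`. -/
noncomputable def theta (ξ τ : ℂ) : ℂ :=
  Complex.exp ((Real.pi : ℂ) * Complex.I * τ / 6) * Complex.exp (-((Real.pi : ℂ) * Complex.I * ξ)) *
    ((∏' j : ℕ, (1 - Complex.exp (2 * (Real.pi : ℂ) * Complex.I * ((j : ℂ) * τ + ξ)))) *
      (∏' j : ℕ, (1 - Complex.exp (2 * (Real.pi : ℂ) * Complex.I * (((j : ℂ) + 1) * τ - ξ)))))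

/-- The `q`-Pochhammer product `∏_{j≥0}(1 − e^{2πi(jτ+ξ)})`. -/
noncomputable def qProd (ξ τ : ℂ) : ℂ :=
  ∏' j : ℕ, (1 - Complex.exp (2 * (Real.pi : ℂ) * Complex.I * ((j : ℂ) * τ + ξ)))

theorem multipliable_qProd {τ : ℂ} (hτ : 0 < τ.im) (ξ : ℂ) :
    Multipliable fun j : ℕ ↦
      1 - Complex.exp (2 * (Real.pi : ℂ) * Complex.I * ((j : ℂ) * τ + ξ)) := by
  have hq : ‖Complex.exp (2 * (Real.pi : ℂ) * Complex.I * τ)‖ < 1 := by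
    rw [Complex.norm_exp, Real.exp_lt_one_iff]
    have : 0 < 2 * Real.pi * τ.im := by positivity
    simpa using this
  simp only [sub_eq_add_neg]
  apply multipliable_one_add_of_summable
  simp only [norm_neg]
  refine ((summable_geometric_of_lt_one (norm_nonneg _) hq).mul_right
    ‖Complex.exp (2 * (Real.pi : ℂ) * Complex.I * ξ)‖).congr fun j ↦ ?_
  rw [← norm_pow, ← norm_mul, ← Complex.exp_nat_mul, ← Complex.exp_add]
  ring_nf

theorem qProd_eq_mul_qProd_add {τ : ℂ} (hτ : 0 < τ.im) (ξ : ℂ) :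
    qProd ξ τ = (1 - Complex.exp (2 * (Real.pi : ℂ) * Complex.I * ξ)) * qProd (ξ + τ) τ := by
  have h : ∀ j : ℕ, ((j + 1 : ℕ) : ℂ) * τ + ξ = (j : ℂ) * τ + (ξ + τ) := fun j ↦ by
    push_cast; ring
  rw [qProd, tprod_eq_zero_mul']
  · simp only [h, Nat.cast_zero, zero_mul, zero_add, qProd]
  · simpa only [h] using multipliable_qProd hτ (ξ + τ)

theorem prod_qProd_add_mul {τ : ℂ} (hτ : 0 < τ.im) {n : ℕ} (hn : n ≠ 0) (ξ : ℂ) :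
    ∏ k ∈ Finset.range n, qProd (ξ + (k : ℂ) * τ) ((n : ℂ) * τ) = qProd ξ τ := by
  have : NeZero n := ⟨hn⟩
  have hnτ : 0 < ((n : ℂ) * τ).im := by
    have : 0 < (n : ℝ) := by positivity
    simpa using mul_pos this hτ
  have key : ∀ p : ℕ × Fin n,
      (((Nat.divModEquiv n).symm p : ℕ) : ℂ) * τ + ξ =
        (p.1 : ℂ) * ((n : ℂ) * τ) + (ξ + ((p.2 : ℕ) : ℂ) * τ) := fun p ↦ by
    simp only [Nat.divModEquiv_symm_apply]; push_cast; ring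
  have hm := (Nat.divModEquiv n).symm.multipliable_iff.mpr (multipliable_qProd hτ ξ)
  simp only [Function.comp_def, key] at hm
  simp only [qProd]
  rw [← Multipliable.tprod_finsetProd fun k _ ↦ multipliable_qProd hnτ _,
    ← (Nat.divModEquiv n).symm.tprod_eq fun j : ℕ ↦
      1 - Complex.exp (2 * (Real.pi : ℂ) * Complex.I * ((j : ℂ) * τ + ξ))]
  simp only [key]
  rw [hm.tprod_prod' fun _ ↦ (hasProd_fintype _).multipliable]
  simp only [tprod_fintype, Finset.prod_range]

theorem theta_eq_qProd (ξ τ : ℂ) :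
    theta ξ τ = Complex.exp ((Real.pi : ℂ) * Complex.I * (τ / 6 - ξ)) *
      (qProd ξ τ * qProd (τ - ξ) τ) := by
  have h : ∀ j : ℕ, ((j : ℂ) + 1) * τ - ξ = (j : ℂ) * τ + (τ - ξ) := fun j ↦ by ring
  simp only [theta, qProd, h, ← Complex.exp_add]
  ring_nf

theorem theta_add_period {τ : ℂ} (hτ : 0 < τ.im) (ξ : ℂ) :
    theta (ξ + τ) τ =
      -Complex.exp (-((Real.pi : ℂ) * Complex.I * (τ + 2 * ξ))) * theta ξ τ := by
  have h₁ := qProd_eq_mul_qProd_add hτ ξ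
  have h₂ := qProd_eq_mul_qProd_add hτ (-ξ)
  have h₃ : Complex.exp (2 * (Real.pi : ℂ) * Complex.I * -ξ) *
      Complex.exp (2 * (Real.pi : ℂ) * Complex.I * ξ) = 1 := by
    rw [← Complex.exp_add]; simp
  have h₄ : Complex.exp (-((Real.pi : ℂ) * Complex.I * (τ + 2 * ξ))) *
      Complex.exp ((Real.pi : ℂ) * Complex.I * (τ / 6 - ξ)) =
      Complex.exp ((Real.pi : ℂ) * Complex.I * (τ / 6 - (ξ + τ))) *
        Complex.exp (2 * (Real.pi : ℂ) * Complex.I * -ξ) := by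
    rw [← Complex.exp_add, ← Complex.exp_add]; ring_nf
  rw [theta_eq_qProd, theta_eq_qProd, show τ - (ξ + τ) = -ξ by ring, h₁, h₂,
    show -ξ + τ = τ - ξ by ring]
  linear_combination
    (1 - Complex.exp (2 * (Real.pi : ℂ) * Complex.I * ξ)) * qProd (ξ + τ) τ *
      qProd (τ - ξ) τ * h₄ -
    Complex.exp ((Real.pi : ℂ) * Complex.I * (τ / 6 - (ξ + τ))) * qProd (ξ + τ) τ *
      qProd (τ - ξ) τ * h₃

theorem theta_add_nat_mul_period {τ : ℂ} (hτ : 0 < τ.im) (ξ : ℂ) (k : ℕ) :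
    theta (ξ + (k : ℂ) * τ) τ =
      (-1) ^ k * Complex.exp (-((Real.pi : ℂ) * Complex.I * ((k : ℂ) ^ 2 * τ + 2 * k * ξ))) *
        theta ξ τ := by
  induction k with
  | zero => simp
  | succ k ih =>
    rw [show ξ + ((k + 1 : ℕ) : ℂ) * τ = ξ + (k : ℂ) * τ + τ by push_cast; ring,
      theta_add_period hτ, ih, pow_succ (-1 : ℂ) k,
      show -((Real.pi : ℂ) * Complex.I * (((k + 1 : ℕ) : ℂ) ^ 2 * τ + 2 * (k + 1 : ℕ) * ξ)) =
        -((Real.pi : ℂ) * Complex.I * (τ + 2 * (ξ + (k : ℂ) * τ))) +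
          -((Real.pi : ℂ) * Complex.I * ((k : ℂ) ^ 2 * τ + 2 * k * ξ)) by push_cast; ring,
      Complex.exp_add]
    ring

theorem prod_theta_add_mul_period {τ : ℂ} (hτ : 0 < τ.im) (ξ : ℂ) (n : ℕ) :
    ∏ k ∈ Finset.range n, theta (ξ + (k : ℂ) * τ) τ =
      (-1) ^ (n * (n - 1) / 2) *
        Complex.exp (-((Real.pi : ℂ) * Complex.I *
          ((n : ℂ) * (n - 1) * (2 * n - 1) / 6 * τ + n * (n - 1) * ξ))) * theta ξ τ ^ n := by
  rw [← Finset.sum_range_id]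
  induction n with
  | zero => simp
  | succ n ih =>
    rw [Finset.prod_range_succ, ih, theta_add_nat_mul_period hτ, Finset.sum_range_succ, pow_add,
      pow_succ (theta ξ τ),
      show -((Real.pi : ℂ) * Complex.I * (((n + 1 : ℕ) : ℂ) * ((n + 1 : ℕ) - 1) *
          (2 * (n + 1 : ℕ) - 1) / 6 * τ + (n + 1 : ℕ) * ((n + 1 : ℕ) - 1) * ξ)) =
        -((Real.pi : ℂ) * Complex.I *
          ((n : ℂ) * (n - 1) * (2 * n - 1) / 6 * τ + n * (n - 1) * ξ)) +
          -((Real.pi : ℂ) * Complex.I * ((n : ℂ) ^ 2 * τ + 2 * n * ξ)) by push_cast; ring,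
      Complex.exp_add]
    ring

theorem prod_exp_add_mul (a τ ξ : ℂ) (n : ℕ) :
    ∏ k ∈ Finset.range n, Complex.exp ((Real.pi : ℂ) * Complex.I * (a - (ξ + (k : ℂ) * τ))) =
      Complex.exp ((Real.pi : ℂ) * Complex.I * (n * a - n * ξ - n * (n - 1) / 2 * τ)) := by
  induction n with
  | zero => simp
  | succ n ih =>
    rw [Finset.prod_range_succ, ih, ← Complex.exp_add]
    push_cast
    ring_nf

theorem prod_theta_add_mul_isogeny {τ : ℂ} (hτ : 0 < τ.im) {n : ℕ} (hn : n ≠ 0) (ξ : ℂ) :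
    ∏ k ∈ Finset.range n, theta (ξ + (k : ℂ) * τ) ((n : ℂ) * τ) =
      Complex.exp ((Real.pi : ℂ) * Complex.I *
        (n * (n * τ / 6) - n * ξ - n * (n - 1) / 2 * τ)) * (qProd ξ τ * qProd (τ - ξ) τ) := by
  have hreflect : ∏ k ∈ Finset.range n, qProd (n * τ - (ξ + (k : ℂ) * τ)) ((n : ℂ) * τ) =
      qProd (τ - ξ) τ := by
    rw [← prod_qProd_add_mul hτ hn, ← Finset.prod_range_reflect]
    refine Finset.prod_congr rfl fun k hk ↦ ?_
    have hk' : n = n - 1 - k + k + 1 := by have := Finset.mem_range.mp hk; lia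
    have hc : (n : ℂ) = (n - 1 - k : ℕ) + k + 1 := by exact_mod_cast hk'
    congr 1
    linear_combination τ * hc
  simp only [theta_eq_qProd, Finset.prod_mul_distrib]
  rw [prod_exp_add_mul, prod_qProd_add_mul hτ hn, hreflect]

/-- The identity `∏_{k=0}^{n−1} θ(ξ + kτ; τ) = (−1)^{n(n−1)/2} (∏_{k=0}^{n−1} θ(ξ + kτ; nτ))^n`
comparing theta functions of the Tate curves with parameters `q` and `q^n` under the
cyclic `n`-isogeny. -/
theorem stmt_7 (τ : ℂ) (hτ : 0 < τ.im) (n : ℕ) (hn : 1 ≤ n) (ξ : ℂ) :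
    ∏ k ∈ Finset.range n, theta (ξ + (k : ℂ) * τ) τ =
      (-1) ^ (n * (n - 1) / 2) *
        (∏ k ∈ Finset.range n, theta (ξ + (k : ℂ) * τ) ((n : ℂ) * τ)) ^ n := by
  have h : Complex.exp (-((Real.pi : ℂ) * Complex.I *
        ((n : ℂ) * (n - 1) * (2 * n - 1) / 6 * τ + n * (n - 1) * ξ))) *
      Complex.exp ((Real.pi : ℂ) * Complex.I * (τ / 6 - ξ)) ^ n =
      Complex.exp ((Real.pi : ℂ) * Complex.I *
        (n * (n * τ / 6) - n * ξ - n * (n - 1) / 2 * τ)) ^ n := by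
    rw [← Complex.exp_nat_mul, ← Complex.exp_nat_mul, ← Complex.exp_add]
    ring_nf
  rw [prod_theta_add_mul_period hτ, prod_theta_add_mul_isogeny hτ (by lia), theta_eq_qProd]
  simp only [mul_pow]
  rw [← h]
  ring
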